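/- arXiv:1802.08500 — 3 statements merged into one kernel-verified Lean document; each statement's English description precedes it below -/
import Mathlib

section
/- Let L be a countable first-order language and M a countably infinite L-structure whose complete theory is ℵ₀-categorical (i.e., any two countable models of the complete theory of M are isomorphic). Then for every natural number n, the action of the automorphism group of M on the set of n-tuples (Fin n → M), acting coordinatewise, has only finitely many orbits. -/
open FirstOrder Cardinal

namespace RN

open FirstOrder.Language

universe u v w w' x y

variable {L : FirstOrder.Language.{u, v}}

/-- Two tuples satisfy the same formulas. -/
def Sim (L : FirstOrder.Language.{u, v}) {α : Type y} {M : Type w} {N : Type w'} [L.Structure M]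
    [L.Structure N] (a : α → M) (b : α → N) : Prop :=
  ∀ φ : L.Formula α, φ.Realize a ↔ φ.Realize b

theorem Sim.comp {α β : Type*} {M : Type w} {N : Type w'} [L.Structure M] [L.Structure N]
    {a : α → M} {b : α → N} (h : Sim L a b) (f : β → α) : Sim L (a ∘ f) (b ∘ f) := by
  intro φ
  simpa [Formula.realize_relabel] using h (φ.relabel f)

theorem Sim.symm {α : Type*} {M : Type w} {N : Type w'} [L.Structure M] [L.Structure N]
    {a : α → M} {b : α → N} (h : Sim L a b) : Sim L b a := fun φ => (h φ).symm

theorem equiv_sim {α : Type*} {M : Type w} {N : Type w'} [L.Structure M] [L.Structure N]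
    (e : M ≃[L] N) (a : α → M) : Sim L a (e ∘ a) := fun φ =>
  (StrongHomClass.realize_formula e φ).symm

/-- Countable structures elementarily equivalent to `M` are isomorphic to `M`. -/
theorem iso_of_cat {M : Type w} [L.Structure M] [Countable M] [Infinite M]
    (hcat : Cardinal.Categorical (ℵ₀ : Cardinal.{x}) (L.completeTheory M))
    (K : Type w') [L.Structure K] [Countable K] (hK : L.ElementarilyEquivalent M K) :
    Nonempty (K ≃[L] M) := by
  have hKinf : Infinite K := hK.infinite_iff.1 inferInstance
  obtain ⟨eM⟩ : Nonempty (M ≃ ULift.{x} ℕ) :=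
    ⟨(Classical.choice (nonempty_equiv_of_countable (α := M) (β := ℕ))).trans Equiv.ulift.symm⟩
  obtain ⟨eK⟩ : Nonempty (K ≃ ULift.{x} ℕ) :=
    ⟨(Classical.choice (nonempty_equiv_of_countable (α := K) (β := ℕ))).trans Equiv.ulift.symm⟩
  let sM : L.Structure (ULift.{x} ℕ) := eM.inducedStructure
  let sK : L.Structure (ULift.{x} ℕ) := eK.inducedStructure
  let fM : @Language.Equiv L M (ULift.{x} ℕ) _ sM := eM.inducedStructureEquiv
  let fK : @Language.Equiv L K (ULift.{x} ℕ) _ sK := eK.inducedStructureEquiv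
  have mM : @Theory.Model L (ULift.{x} ℕ) sM (L.completeTheory M) :=
    (@StrongHomClass.theory_model L M (ULift.{x} ℕ) _ sM (L.completeTheory M) _ _ _ fM _)
  have mK0 : K ⊨ L.completeTheory M := by
    rw [show L.completeTheory M = L.completeTheory K from hK]; infer_instance
  have mK : @Theory.Model L (ULift.{x} ℕ) sK (L.completeTheory M) :=
    (@StrongHomClass.theory_model L K (ULift.{x} ℕ) _ sK (L.completeTheory M) _ _ _ fK mK0)
  obtain ⟨g⟩ := hcat (@Theory.ModelType.mk L (L.completeTheory M) (ULift.{x} ℕ) sK mK _)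
    (@Theory.ModelType.mk L (L.completeTheory M) (ULift.{x} ℕ) sM mM _) (by simp) (by simp)
  exact ⟨(@Language.Equiv.comp L K (ULift.{x} ℕ) _ sK M _
    (@Language.Equiv.comp L (ULift.{x} ℕ) (ULift.{x} ℕ) sK sM M _
    (@Language.Equiv.symm L _ _ _ sM fM) g) fK)⟩

/-- Compactness via ultrapowers. -/
theorem exists_ultra {M : Type w} [L.Structure M] [Nonempty M] {α : Type y}
    (Γ : Set (L.Formula α))
    (h : ∀ s : Finset Γ, ∃ v : α → M, ∀ φ ∈ s, φ.1.Realize v) :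
    ∃ (N : Type (max u v w y)) (_ : L.Structure N), L.ElementarilyEquivalent M N ∧
      ∃ v : α → N, ∀ φ ∈ Γ, φ.Realize v := by
  classical
  choose v hv using h
  let U : Ultrafilter (Finset Γ) := Ultrafilter.of Filter.atTop
  refine ⟨(U : Filter (Finset Γ)).Product (fun _ => M), inferInstance, ?_,
    fun i => Quotient.mk _ (fun s => v s i), ?_⟩
  · rw [elementarilyEquivalent_iff]
    intro φ
    rw [Ultraproduct.sentence_realize]
    simp
  · intro φ hφ
    refine (Ultraproduct.realize_formula_cast (u := U) (M := fun _ => M) φ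
      (fun i s => v s i)).2 ?_
    refine Filter.Eventually.filter_mono (Ultrafilter.of_le _) ?_
    refine Filter.eventually_atTop.2 ⟨{⟨φ, hφ⟩}, fun s hs => ?_⟩
    exact hv s _ (hs (Finset.mem_singleton_self _))

/-- A finitely satisfiable set of formulas in finitely many variables is realized in `M`. -/
theorem realized_of_finsat [Countable L.Symbols] {M : Type w} [L.Structure M] [Countable M]
    [Infinite M] (hcat : Cardinal.Categorical (ℵ₀ : Cardinal.{x}) (L.completeTheory M)) {n : ℕ}
    (Γ : Set (L.Formula (Fin n)))
    (h : ∀ s : Finset Γ, ∃ v : Fin n → M, ∀ φ ∈ s, φ.1.Realize v) :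
    ∃ v : Fin n → M, ∀ φ ∈ Γ, φ.Realize v := by
  obtain ⟨N, sN, hN, v, hv⟩ := exists_ultra Γ h
  have hNinf : Infinite N := hN.infinite_iff.1 inferInstance
  obtain ⟨S, hS, hcard⟩ := exists_elementarySubstructure_card_eq L (Set.range v)
    (ℵ₀ : Cardinal.{max u v w}) le_rfl
    (by simp) (by
      have : L.card ≤ ℵ₀ := by
        rw [Language.card]; exact Cardinal.mk_le_aleph0_iff.2 inferInstance
      simpa using this) (by simp)
  have hSc : Countable S := by
    rw [← Cardinal.mk_le_aleph0_iff]
    simp at hcard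
    exact hcard.le
  obtain ⟨e⟩ := iso_of_cat hcat S (hN.trans S.elementarilyEquivalent.symm)
  let v' : Fin n → S := fun i => ⟨v i, hS ⟨i, rfl⟩⟩
  refine ⟨e ∘ v', fun φ hφ => ?_⟩
  rw [← equiv_sim e v' φ, ← S.subtype.map_formula]
  exact hv φ hφ

/-- Formulas over `ℕ` only use finitely many variables. -/
theorem exists_fin (θ : L.Formula ℕ) : ∃ (m : ℕ) (θ' : L.Formula (Fin m)),
    ∀ {M : Type w} [L.Structure M] (v : ℕ → M), θ'.Realize (fun i => v i) ↔ θ.Realize v := by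
  classical
  obtain ⟨m, hm⟩ := (BoundedFormula.freeVarFinset θ).exists_nat_subset_range
  refine ⟨m, BoundedFormula.restrictFreeVar θ
    (fun i => ⟨i.1, Finset.mem_range.1 (hm i.2)⟩), fun v => ?_⟩
  exact BoundedFormula.realize_restrictFreeVar v (fun _ => rfl)

theorem exists_fresh (θ : L.Formula ℕ) : ∃ m : ℕ, ∀ {M : Type w} [L.Structure M] (v v' : ℕ → M),
    (∀ i < m, v i = v' i) → (θ.Realize v ↔ θ.Realize v') := by
  obtain ⟨m, θ', h⟩ := exists_fin θ
  refine ⟨m, fun v v' hv => ?_⟩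
  rw [← h, ← h, show (fun i : Fin m => v i) = (fun i : Fin m => v' i) from
    funext fun i => hv i i.2]

/-- The forcing conditions in the omitting types argument. -/
def Cond (L : FirstOrder.Language.{u, v}) (M : Type w) [L.Structure M] : Type (max u v) :=
  {θ : L.Formula ℕ // ∃ v : ℕ → M, θ.Realize v}

instance (M : Type w) [L.Structure M] : Preorder (Cond L M) where
  le p q := ∀ v : ℕ → M, q.1.Realize v → p.1.Realize v
  le_refl _ _ h := h
  le_trans _ _ _ hab hbc v hv := hab v (hbc v hv)

/-- The instance of `φ` at the variable `k`. -/
def inst (φ : L.Formula (ℕ ⊕ Fin 1)) (k : ℕ) : L.Formula ℕ :=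
  φ.relabel (Sum.elim id (fun _ => k))

theorem realize_inst {M : Type w} [L.Structure M] (φ : L.Formula (ℕ ⊕ Fin 1)) (k : ℕ)
    (v : ℕ → M) : (inst φ k).Realize v ↔ φ.Realize (Sum.elim v (fun _ => v k)) := by
  rw [inst, Formula.realize_relabel]
  have : v ∘ Sum.elim id (fun _ : Fin 1 => k) = Sum.elim v (fun _ => v k) := by
    ext i; cases i <;> rfl
  rw [this]

/-- Density of the Henkin conditions. -/
theorem henkin_dense {M : Type w} [L.Structure M] (φ : L.Formula (ℕ ⊕ Fin 1)) :
    IsCofinal {θ : Cond L M | (∀ v : ℕ → M, θ.1.Realize v → (φ.iExs (Fin 1)).not.Realize v) ∨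
      ∃ k, ∀ v : ℕ → M, θ.1.Realize v → (inst φ k).Realize v} := by
  rintro ⟨θ, v, hv⟩
  by_cases h : (φ.iExs (Fin 1)).Realize v
  · obtain ⟨c, hc⟩ := Formula.realize_iExs.1 h
    obtain ⟨m₁, h₁⟩ := exists_fresh.{u, v, w} θ
    obtain ⟨m₂, h₂⟩ := exists_fresh.{u, v, w}
      (φ.relabel (Sum.elim Nat.succ (fun _ => 0)))
    have key : ∀ (w : ℕ → M) (c : Fin 1 → M),
        (φ.relabel (Sum.elim Nat.succ (fun _ => 0) : ℕ ⊕ Fin 1 → ℕ)).Realize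
          (fun i => Nat.casesOn i (c 0) w : ℕ → M) ↔ φ.Realize (Sum.elim w c) := by
      intro w c
      rw [Formula.realize_relabel]
      have : (fun i => Nat.casesOn i (c 0) w : ℕ → M) ∘ (Sum.elim Nat.succ (fun _ : Fin 1 => 0))
          = Sum.elim w c := by
        ext i
        rcases i with i | i
        · rfl
        · rw [Subsingleton.elim i 0]; rfl
      rw [this]
    let k := max m₁ m₂
    let v' : ℕ → M := Function.update v k (c 0)
    have hv' : θ.Realize v' := (h₁ v v' fun i hi => by
      simp only [v']
      rw [Function.update_of_ne]
      omega).1 hv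
    have hφ' : (inst φ k).Realize v' := by
      rw [realize_inst, ← key]
      rw [← key] at hc
      refine (h₂ _ _ fun i hi => ?_).1 hc
      rcases i with _ | i
      · simp [v']
      · simp only [v']
        rw [Function.update_of_ne]
        omega
    refine ⟨⟨θ ⊓ inst φ k, v', ?_⟩, Or.inr ⟨k, fun w hw => ?_⟩, fun w hw => ?_⟩
    · exact Formula.realize_inf.2 ⟨hv', hφ'⟩
    · exact (Formula.realize_inf.1 hw).2
    · exact (Formula.realize_inf.1 hw).1
  · refine ⟨⟨θ ⊓ (φ.iExs (Fin 1)).not, v, ?_⟩, Or.inl fun w hw => ?_, fun w hw => ?_⟩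
    · exact Formula.realize_inf.2 ⟨hv, Formula.realize_not.2 h⟩
    · exact (Formula.realize_inf.1 hw).2
    · exact (Formula.realize_inf.1 hw).1

/-- Density of the omitting conditions. -/
theorem avoid_dense {M : Type w} [L.Structure M] {n : ℕ} (a : Fin n → M)
    (ha : ∀ φ : L.Formula (Fin n), φ.Realize a → ∃ b : Fin n → M, φ.Realize b ∧ ¬ Sim L a b)
    (i : Fin n → ℕ) :
    IsCofinal {θ : Cond L M | ∃ ψ : L.Formula (Fin n), ψ.Realize a ∧
      ∀ v : ℕ → M, θ.1.Realize v → (ψ.relabel i).not.Realize v} := by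
  rintro ⟨θ, v, hv⟩
  by_cases h : ∃ ψ : L.Formula (Fin n), ψ.Realize a ∧ ∃ v' : ℕ → M, θ.Realize v' ∧
      ¬ (ψ.relabel i).Realize v'
  · obtain ⟨ψ, hψ, v', hv', hn⟩ := h
    refine ⟨⟨θ ⊓ (ψ.relabel i).not, v', ?_⟩, ⟨ψ, hψ, fun w hw => ?_⟩, fun w hw => ?_⟩
    · exact Formula.realize_inf.2 ⟨hv', Formula.realize_not.2 hn⟩
    · exact (Formula.realize_inf.1 hw).2
    · exact (Formula.realize_inf.1 hw).1
  exfalso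
  push Not at h
  have hall : ∀ v' : ℕ → M, θ.Realize v' → Sim L a (v' ∘ i) := by
    intro v' hv' ψ
    constructor
    · intro hψ
      exact Formula.realize_relabel.1 (h ψ hψ v' hv')
    · intro hψ
      by_contra hn
      have := h ψ.not (Formula.realize_not.2 hn) v' hv'
      rw [Formula.realize_relabel, Formula.realize_not] at this
      exact this hψ
  obtain ⟨m₀, h₀⟩ := exists_fresh.{u, v, w} θ
  obtain ⟨m, hm₀, hm⟩ : ∃ m, m₀ ≤ m ∧ ∀ j, i j < m := by
    refine ⟨max m₀ ((Finset.univ.sup i) + 1), le_max_left _ _, fun j => ?_⟩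
    exact lt_of_lt_of_le (Nat.lt_succ_of_le (Finset.le_sup (Finset.mem_univ j))) (le_max_right _ _)
  have : Nonempty M := ⟨v 0⟩
  -- the restriction of `θ` to the first `m` variables
  let r : ℕ → Fin (m + 1) := fun j => if hj : j < m then ⟨j, by omega⟩ else ⟨m, by omega⟩
  have hD : (∅ : Set M).Definable L {g : Fin (m + 1) → M | (θ.relabel r).Realize g} :=
    Set.empty_definable_iff.2 ⟨θ.relabel r, rfl⟩
  obtain ⟨χ, hχ⟩ := Set.empty_definable_iff.1 (hD.image_comp (r ∘ i))
  have hχ' : ∀ b : Fin n → M, χ.Realize b ↔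
      ∃ g : Fin (m + 1) → M, θ.Realize (g ∘ r) ∧ (g ∘ r) ∘ i = b := by
    intro b
    have := Set.ext_iff.1 hχ b
    simpa [Formula.realize_relabel, Function.comp_assoc] using this.symm
  have hva : χ.Realize (v ∘ i) := by
    rw [hχ']
    have hlt : ∀ j < m, ((fun j : Fin (m + 1) => v j) ∘ r) j = v j := by
      intro j hj
      simp [r, hj]
    refine ⟨fun j => v j, ?_, ?_⟩
    · exact (h₀ _ _ fun j hj => hlt j (by omega)).2 hv
    · ext j
      exact hlt _ (hm j)
  obtain ⟨b, hb, hnb⟩ := ha χ ((hall v hv χ).2 hva)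
  obtain ⟨g, hg, rfl⟩ := (hχ' b).1 hb
  exact hnb (hall _ hg)

/-- In the countable model of an `ℵ₀`-categorical theory every tuple has an isolated type. -/
theorem isolated [Countable L.Symbols] {M : Type w} [L.Structure M] [Countable M]
    [Infinite M] (hcat : Cardinal.Categorical (ℵ₀ : Cardinal.{x}) (L.completeTheory M)) {n : ℕ}
    (a : Fin n → M) :
    ∃ φ : L.Formula (Fin n), φ.Realize a ∧ ∀ b : Fin n → M, φ.Realize b → Sim L a b := by
  classical
  by_contra! ha
  let ι := L.Formula (ℕ ⊕ Fin 1) ⊕ (Fin n → ℕ)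
  have : Encodable ι := Encodable.ofCountable ι
  let D : ι → Order.Cofinal (Cond L M) := fun j => Sum.casesOn j
    (fun φ => ⟨_, henkin_dense φ⟩) (fun i => ⟨_, avoid_dense a ha i⟩)
  let p₀ : Cond L M := ⟨⊤, fun _ => Classical.arbitrary M, by simp⟩
  let I := Order.idealOfCofinals p₀ D
  let Γ : Set (L.Formula ℕ) := {ψ | ∃ θ ∈ I, ∀ v : ℕ → M, θ.1.Realize v → ψ.Realize v}
  have hΓ : ∀ s : Finset Γ, ∃ θ ∈ I, ∀ ψ ∈ s, ∀ v : ℕ → M, θ.1.Realize v → ψ.1.Realize v := by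
    intro s
    induction s using Finset.induction_on with
    | empty => exact ⟨p₀, Order.mem_idealOfCofinals p₀ D, by simp⟩
    | insert ψ s _ ih =>
      obtain ⟨θ, hθ, h⟩ := ih
      obtain ⟨θ', hθ', h'⟩ := ψ.2
      obtain ⟨q, hq, h₁, h₂⟩ := I.directed θ hθ θ' hθ'
      refine ⟨q, hq, fun ψ' hψ' v hv => ?_⟩
      rcases Finset.mem_insert.1 hψ' with rfl | hψ'
      · exact h' v (h₂ v hv)
      · exact h ψ' hψ' v (h₁ v hv)
  obtain ⟨N, sN, hN, v, hv⟩ := exists_ultra (M := M) Γ (fun s => by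
    obtain ⟨θ, -, h⟩ := hΓ s
    obtain ⟨v, hv⟩ := θ.2
    exact ⟨v, fun ψ hψ => h ψ hψ v hv⟩)
  have hmeet : L.MeetsDefinable (Set.range v) := by
    intro E hne hdef
    obtain ⟨φ, hφ⟩ := Set.definable_iff_exists_formula_sum.1 hdef
    let c : Set.range v → ℕ := fun y => y.2.choose
    have hc : ∀ y : Set.range v, v (c y) = y := fun y => y.2.choose_spec
    let φ' : L.Formula (ℕ ⊕ Fin 1) := φ.relabel (Sum.map c id)
    have hφ' : ∀ z : Fin 1 → N, φ'.Realize (Sum.elim v z) ↔ z 0 ∈ E := by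
      intro z
      have h1 := Set.ext_iff.1 hφ z
      rw [Formula.realize_relabel]
      have h2 : Sum.elim v z ∘ Sum.map c id = Sum.elim (fun y : Set.range v => (y : N)) z := by
        ext j
        rcases j with j | j
        · exact hc j
        · rfl
      rw [h2]
      exact h1.symm
    obtain ⟨θ, hθ, hθI⟩ := Order.cofinal_meets_idealOfCofinals p₀ D (Sum.inl φ')
    rcases hθ with hθ | ⟨k, hk⟩
    · have := hv _ ⟨θ, hθI, hθ⟩
      rw [Formula.realize_not, Formula.realize_iExs] at this
      obtain ⟨z, hz⟩ := hne
      exact (this ⟨fun _ => z, (hφ' _).2 hz⟩).elim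
    · have := hv _ ⟨θ, hθI, hk⟩
      rw [realize_inst, hφ'] at this
      exact ⟨v k, this, k, rfl⟩
  let S := hmeet.toElementarySubstructure
  have hSmem : ∀ z : N, z ∈ S ↔ z ∈ Set.range v := fun z =>
    Set.ext_iff.1 hmeet.closure_eq_self z
  have hSc : Countable S := by
    have : Set.Countable (S : Set N) := by
      refine (Set.countable_range v).mono fun z hz => (hSmem z).1 hz
    exact this.to_subtype
  obtain ⟨e⟩ := iso_of_cat hcat S (hN.trans S.elementarilyEquivalent.symm)
  have hb : ∀ j, ∃ k, v k = (e.symm (a j) : N) := fun j => (hSmem _).1 (e.symm (a j)).2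
  choose i hi using hb
  obtain ⟨θ, ⟨ψ, hψ, hθ⟩, hθI⟩ := Order.cofinal_meets_idealOfCofinals p₀ D (Sum.inr i)
  have h1 := hv _ ⟨θ, hθI, hθ⟩
  rw [Formula.realize_not, Formula.realize_relabel] at h1
  apply h1
  have h2 : v ∘ i = S.subtype ∘ (e.symm ∘ a) := by
    ext j; exact hi j
  rw [h2, S.subtype.map_formula]
  exact (equiv_sim e.symm a ψ).1 hψ

/-- One step of the back-and-forth. -/
theorem step {M : Type w} [L.Structure M]
    (hiso : ∀ (n : ℕ) (a : Fin n → M), ∃ φ : L.Formula (Fin n), φ.Realize a ∧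
      ∀ b : Fin n → M, φ.Realize b → Sim L a b)
    {α : Type y} [Finite α] {a b : α → M} (h : Sim L a b) (c : M) :
    ∃ d : M, Sim L (Sum.elim a (fun _ : Fin 1 => c)) (Sum.elim b (fun _ : Fin 1 => d)) := by
  obtain ⟨n, ⟨e⟩⟩ := Finite.exists_equiv_fin (α ⊕ Fin 1)
  obtain ⟨φ, hφ, hφ'⟩ := hiso n (Sum.elim a (fun _ : Fin 1 => c) ∘ e.symm)
  let χ : L.Formula (α ⊕ Fin 1) := φ.relabel e.symm
  have h1 : (χ.iExs (Fin 1)).Realize a :=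
    Formula.realize_iExs.2 ⟨fun _ => c, Formula.realize_relabel.2 hφ⟩
  obtain ⟨d, hd⟩ := Formula.realize_iExs.1 ((h _).1 h1)
  have h2 := (hφ' _ (Formula.realize_relabel.1 hd)).comp e
  refine ⟨d 0, ?_⟩
  have h3 : (fun _ : Fin 1 => d 0) = d := by
    ext i; rw [Subsingleton.elim i 0]
  rw [h3]
  simpa [Function.comp_assoc] using h2

/-- Finite partial elementary maps. -/
def PEl (L : FirstOrder.Language.{u, v}) (M : Type w) [L.Structure M] : Type w :=
  {s : Finset (M × M) // Sim L (fun i : s => i.1.1) (fun i : s => i.1.2)}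

instance (M : Type w) [L.Structure M] : Preorder (PEl L M) where
  le p q := p.1 ⊆ q.1
  le_refl _ _ h := h
  le_trans _ _ _ h h' _ hv := h' (h hv)

open Classical in
theorem PEl.insert {M : Type w} [L.Structure M] (s : PEl L M) (c d : M)
    (h : Sim L (Sum.elim (fun i : s.1 => i.1.1) (fun _ : Fin 1 => c))
      (Sum.elim (fun i : s.1 => i.1.2) (fun _ : Fin 1 => d))) :
    ∃ t : PEl L M, s ≤ t ∧ (c, d) ∈ t.1 := by
  refine ⟨⟨Insert.insert (c, d) s.1, ?_⟩, Finset.subset_insert _ _, Finset.mem_insert_self _ _⟩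
  let g : (Insert.insert (c, d) s.1 : Finset (M × M)) → s.1 ⊕ Fin 1 := fun i =>
    if hi : i.1 ∈ s.1 then Sum.inl ⟨i.1, hi⟩ else Sum.inr 0
  have hcomp := h.comp g
  have e1 : Sum.elim (fun i : s.1 => i.1.1) (fun _ : Fin 1 => c) ∘ g = fun i => i.1.1 := by
    ext ⟨i, hi⟩
    by_cases hs : i ∈ s.1
    · simp [g, hs]
    · have : i = (c, d) := by simpa [hs] using hi
      subst this
      simp [g, hs]
  have e2 : Sum.elim (fun i : s.1 => i.1.2) (fun _ : Fin 1 => d) ∘ g = fun i => i.1.2 := by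
    ext ⟨i, hi⟩
    by_cases hs : i ∈ s.1
    · simp [g, hs]
    · have : i = (c, d) := by simpa [hs] using hi
      subst this
      simp [g, hs]
  rwa [e1, e2] at hcomp

/-- Back-and-forth: tuples with the same type are conjugate. -/
theorem exists_aut {M : Type w} [L.Structure M] [Countable M]
    (hiso : ∀ (n : ℕ) (a : Fin n → M), ∃ φ : L.Formula (Fin n), φ.Realize a ∧
      ∀ b : Fin n → M, φ.Realize b → Sim L a b)
    {n : ℕ} {a b : Fin n → M} (h : Sim L a b) : ∃ π : M ≃[L] M, ⇑π ∘ a = b := by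
  classical
  let p₀ : PEl L M := ⟨Finset.univ.image (fun i => (a i, b i)), by
    have hc : ∀ z : Finset.univ.image (fun i => (a i, b i)), ∃ i, (a i, b i) = z.1 := by
      rintro ⟨z, hz⟩
      simpa using hz
    choose g hg using hc
    have hcomp := h.comp g
    have e1 : a ∘ g = fun i => i.1.1 := by ext i; simp [← hg i]
    have e2 : b ∘ g = fun i => i.1.2 := by ext i; simp [← hg i]
    rwa [e1, e2] at hcomp⟩
  have : Encodable (M ⊕ M) := Encodable.ofCountable _
  let D : M ⊕ M → Order.Cofinal (PEl L M) := fun j => Sum.casesOn j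
    (fun c => ⟨{s | ∃ d, (c, d) ∈ s.1}, fun s => by
      obtain ⟨d, hd⟩ := step hiso s.2 c
      obtain ⟨t, h1, h2⟩ := PEl.insert s c d hd
      exact ⟨t, ⟨d, h2⟩, h1⟩⟩)
    (fun d => ⟨{s | ∃ c, (c, d) ∈ s.1}, fun s => by
      obtain ⟨c, hc⟩ := step hiso s.2.symm d
      obtain ⟨t, h1, h2⟩ := PEl.insert s c d hc.symm
      exact ⟨t, ⟨c, h2⟩, h1⟩⟩)
  let I := Order.idealOfCofinals p₀ D
  let R : M → M → Prop := fun c d => ∃ s ∈ I, (c, d) ∈ s.1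
  have hR : ∀ (k : ℕ) (c d : Fin k → M), (∀ i, R (c i) (d i)) → Sim L c d := by
    intro k c d hcd
    have hex : ∀ J : Finset (Fin k), ∃ s ∈ I, ∀ i ∈ J, (c i, d i) ∈ s.1 := by
      intro J
      induction J using Finset.induction_on with
      | empty => exact ⟨p₀, Order.mem_idealOfCofinals p₀ D, by simp⟩
      | insert j J _ ih =>
        obtain ⟨s, hs, h1⟩ := ih
        obtain ⟨t, ht, h2⟩ := hcd j
        obtain ⟨q, hq, hsq, htq⟩ := I.directed s hs t ht
        refine ⟨q, hq, fun i hi => ?_⟩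
        rcases Finset.mem_insert.1 hi with rfl | hi
        · exact htq h2
        · exact hsq (h1 i hi)
    obtain ⟨s, -, hs⟩ := hex Finset.univ
    exact s.2.comp (fun i => ⟨(c i, d i), hs i (Finset.mem_univ i)⟩)
  have hinj : ∀ c d c' d', R c d → R c' d' → (c = c' ↔ d = d') := by
    intro c d c' d' h1 h2
    have := hR 2 ![c, c'] ![d, d'] (by
      intro i
      fin_cases i
      · exact h1
      · exact h2) (Term.equal (Term.var 0) (Term.var 1))
    simpa using this
  have hf : ∀ c, ∃ d, R c d := by
    intro c
    obtain ⟨s, ⟨d, hd⟩, hs⟩ := Order.cofinal_meets_idealOfCofinals p₀ D (Sum.inl c)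
    exact ⟨d, s, hs, hd⟩
  have hg : ∀ d, ∃ c, R c d := by
    intro d
    obtain ⟨s, ⟨c, hc⟩, hs⟩ := Order.cofinal_meets_idealOfCofinals p₀ D (Sum.inr d)
    exact ⟨c, s, hs, hc⟩
  choose f hf using hf
  choose g hg using hg
  refine ⟨{ toFun := f, invFun := g, left_inv := ?_, right_inv := ?_, map_fun' := ?_,
            map_rel' := ?_ }, ?_⟩
  · intro c
    exact (hinj _ _ _ _ (hg (f c)) (hf c)).2 rfl
  · intro d
    exact (hinj _ _ _ _ (hf (g d)) (hg d)).1 rfl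
  · intro k F xs
    have := hR (k + 1) (Fin.snoc xs (Structure.funMap F xs))
      (Fin.snoc (f ∘ xs) (f (Structure.funMap F xs))) (by
        intro i
        refine Fin.lastCases ?_ (fun i => ?_) i
        · simpa using hf _
        · simpa using hf _)
      (Term.equal (Term.func F (fun i => Term.var i.castSucc)) (Term.var (Fin.last k)))
    simp [Term.realize] at this
    exact this.symm
  · intro k r xs
    have := hR k xs (f ∘ xs) (fun i => hf _) (Relations.formula r (fun i => Term.var i))
    simp [Formula.realize_rel] at this
    exact this.symm
  · ext i
    refine (hinj _ _ _ _ (hf (a i)) ⟨p₀, Order.mem_idealOfCofinals p₀ D, ?_⟩).1 rfl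
    exact Finset.mem_image_of_mem (fun i => (a i, b i)) (Finset.mem_univ i)

end RN

/-- Ryll-Nardzewski–Engeler–Svenonius, one direction: if the complete theory of a countably
infinite structure `M` over a countable language is ℵ₀-categorical, then for every `n` the
automorphism group of `M` has finitely many orbits on `n`-tuples. -/
theorem stmt_0 (L : FirstOrder.Language) [Countable L.Symbols]
    (M : Type*) [L.Structure M] [Countable M] [Infinite M]
    (hcat : Cardinal.Categorical ℵ₀ (L.completeTheory M)) (n : ℕ) :
    Finite (Quot (fun a b : Fin n → M => ∃ π : M ≃[L] M, ⇑π ∘ a = b)) := by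
  classical
  choose φ hφ hφ' using fun a : Fin n → M => RN.isolated hcat a
  have hex : ∃ s : Finset (Fin n → M), ∀ v : Fin n → M, ∃ a ∈ s, (φ a).Realize v := by
    by_contra! hno
    obtain ⟨v, hv⟩ := RN.realized_of_finsat hcat (Set.range fun a => (φ a).not) (by
      intro s
      have hc : ∀ ψ : Set.range fun a => (φ a).not, ∃ a, (φ a).not = ψ.1 := fun ψ => ψ.2
      choose c hc using hc
      obtain ⟨v, hv⟩ := hno (s.image c)
      refine ⟨v, fun ψ hψ => ?_⟩
      rw [← hc ψ]
      exact FirstOrder.Language.Formula.realize_not.2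
        (hv _ (Finset.mem_image_of_mem c hψ)))
    exact FirstOrder.Language.Formula.realize_not.1 (hv _ ⟨v, rfl⟩) (hφ v)
  obtain ⟨s, hs⟩ := hex
  refine Finite.of_surjective (fun a : s => Quot.mk _ a.1) ?_
  rintro ⟨v⟩
  obtain ⟨a, ha, hav⟩ := hs v
  exact ⟨⟨a, ha⟩, Quot.sound (RN.exists_aut (fun _ a => RN.isolated hcat a) (hφ' a v hav))⟩
end

section
/- Let L be a countable first-order language and M a countably infinite L-structure whose complete theory is ℵ₀-categorical. Let A ⊆ M be a finite set and X ⊆ (Fin n → M) a set definable in L with parameters from A. Then X is a finite union of orbits of the coordinatewise action on (Fin n → M) of the group of automorphisms of M fixing A pointwise. -/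
open FirstOrder Cardinal

namespace RN
open FirstOrder.Language FirstOrder.Language.Theory Set

universe u v w w'
variable {L : FirstOrder.Language.{u, v}}

/-- The truth of a formula only depends on the values of finitely many variables. -/
theorem exists_bound {α : Type w} (φ : L.Formula α) :
    ∃ s : Finset α, ∀ (N : Type w') [L.Structure N] (x y : α → N), (∀ a ∈ s, x a = y a) →
      φ.Realize x → φ.Realize y := by
  classical
  refine ⟨φ.freeVarFinset, fun N _ x y h hx => ?_⟩
  have h1 := (BoundedFormula.realize_restrictFreeVar (φ := φ) (f := id)
    (v := fun a => x a) (v' := x) (xs := default) (fun _ => rfl)).2 hx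
  exact (BoundedFormula.realize_restrictFreeVar (φ := φ) (f := id)
    (v := fun a => x a) (v' := y) (xs := default) (fun a => h a a.2)).1 h1

/-- membership of a formula in a type -/
def Has {T : L.Theory} {α : Type w} (p : T.CompleteType α) (φ : L.Formula α) : Prop :=
  Formula.equivSentence φ ∈ p

theorem has_typeOf {T : L.Theory} {α : Type w} {N : Type w'} [L.Structure N] [Nonempty N]
    [N ⊨ T] (x : α → N) (φ : L.Formula α) : Has (T.typeOf x) φ ↔ φ.Realize x :=
  CompleteType.formula_mem_typeOf

theorem isOpen_has {T : L.Theory} {α : Type w} (φ : L.Formula α) :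
    IsOpen {p : T.CompleteType α | Has p φ} :=
  CompleteType.isOpen_typesWith _

theorem has_ext {T : L.Theory} {α : Type w} {p q : T.CompleteType α}
    (h : ∀ φ, Has p φ → Has q φ) : p = q := by
  have h1 : ∀ ψ : L[[α]].Sentence, ψ ∈ p → ψ ∈ q := by
    intro ψ hψ
    have := h (Formula.equivSentence.symm ψ)
    simpa [Has] using this (by simpa [Has] using hψ)
  apply SetLike.ext
  intro ψ
  refine ⟨h1 ψ, fun hq => ?_⟩
  by_contra hp
  rw [← CompleteType.not_mem_iff] at hp
  exact (CompleteType.not_mem_iff q ψ).1 (h1 _ hp) hq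

theorem exists_has_of_isOpen {T : L.Theory} {α : Type w} {U : Set (T.CompleteType α)}
    (hU : IsOpen U) {p} (hp : p ∈ U) :
    ∃ φ : L.Formula α, Has p φ ∧ ∀ q : T.CompleteType α, Has q φ → q ∈ U := by
  obtain ⟨_, ⟨ψ, rfl⟩, h1, h2⟩ :=
    CompleteType.isTopologicalBasis_range_typesWith.exists_subset_of_mem_open hp hU
  refine ⟨Formula.equivSentence.symm ψ, by simpa [Has] using h1, fun q hq => h2 ?_⟩
  simpa [Has] using hq

theorem dense_of {T : L.Theory} {α : Type w} {D : Set (T.CompleteType α)}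
    (h : ∀ (θ : L.Formula α) (N : ModelType.{u, v, max u v w} T) (x : α → N), θ.Realize x →
      ∃ q ∈ D, Has q θ) : Dense D := by
  rw [dense_iff_inter_open]
  rintro U hU ⟨p, hp⟩
  obtain ⟨θ, h1, h2⟩ := exists_has_of_isOpen hU hp
  obtain ⟨N, x, rfl⟩ := exists_modelType_is_realized_in T p
  obtain ⟨q, hq, hq'⟩ := h θ N x ((has_typeOf x θ).1 h1)
  exact ⟨q, h2 q hq', hq⟩

/-- Types satisfying the Henkin condition for `φ`. -/
def henkin (T : L.Theory) (φ : L.Formula (ℕ ⊕ Fin 1)) : Set (T.CompleteType ℕ) :=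
  {p | Has p (φ.iExs (Fin 1)).not} ∪
    ⋃ k : ℕ, {p | Has p (φ.relabel (Sum.elim id fun _ => k))}

theorem henkin_open (T : L.Theory) (φ : L.Formula (ℕ ⊕ Fin 1)) : IsOpen (henkin T φ) :=
  (isOpen_has _).union (isOpen_iUnion fun _ => isOpen_has _)

theorem henkin_dense_s7 (T : L.Theory) (φ : L.Formula (ℕ ⊕ Fin 1)) : Dense (henkin T φ) := by
  classical
  apply dense_of
  intro θ N x hx
  by_cases hex : ∃ c : Fin 1 → N, φ.Realize (Sum.elim x c)
  · obtain ⟨c, hc⟩ := hex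
    obtain ⟨s, hs⟩ := exists_bound.{u, v, 0, max u v} θ
    obtain ⟨t, ht⟩ := exists_bound.{u, v, 0, max u v} φ
    obtain ⟨k, hk⟩ := Infinite.exists_notMem_finset (s ∪ t.toLeft)
    simp only [Finset.mem_union, not_or, Finset.mem_toLeft] at hk
    refine ⟨T.typeOf (Function.update x k (c 0)), Or.inr (mem_iUnion.2 ⟨k, ?_⟩), ?_⟩
    · rw [Set.mem_ofPred_eq]
      rw [has_typeOf, Formula.realize_relabel]
      refine ht N _ _ ?_ hc
      rintro (a | a) ha
      · have : a ≠ k := by rintro rfl; exact hk.2 ha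
        simp [this]
      · simp [Subsingleton.elim a 0]
    · rw [has_typeOf]
      refine hs N _ _ ?_ hx
      intro a ha
      have : a ≠ k := by rintro rfl; exact hk.1 ha
      simp [this]
  · refine ⟨T.typeOf x, Or.inl ?_, (has_typeOf _ _).2 hx⟩
    rw [Set.mem_ofPred_eq]
    rw [has_typeOf, Formula.realize_not, Formula.realize_iExs]
    exact hex

/-- Types in which the tuple `i` does not realize `p`. -/
def omits {T : L.Theory} {α : Type w} (p : T.CompleteType α) (i : α → ℕ) :
    Set (T.CompleteType ℕ) :=
  ⋃ ψ : {ψ : L.Formula α // ¬ Has p ψ}, {q | Has q (ψ.1.relabel i)}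

theorem omits_open {T : L.Theory} {α : Type w} (p : T.CompleteType α) (i : α → ℕ) :
    IsOpen (omits p i) := isOpen_iUnion fun _ => isOpen_has _

theorem not_omits {T : L.Theory} {α : Type w} {p : T.CompleteType α} {i : α → ℕ}
    {N : Type w'} [L.Structure N] [Nonempty N] [N ⊨ T] {x : ℕ → N}
    (h : T.typeOf x ∉ omits p i) : T.typeOf (x ∘ i) = p := by
  apply has_ext
  intro ψ hψ
  by_contra hp
  refine h (mem_iUnion.2 ⟨⟨ψ, hp⟩, ?_⟩)
  rw [Set.mem_ofPred_eq]
  rw [has_typeOf] at hψ ⊢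
  rwa [Formula.realize_relabel]

theorem omits_dense {T : L.Theory} {α : Type} [Finite α] (p : T.CompleteType α)
    (hp : ¬ IsOpen {p}) (i : α → ℕ) : Dense (omits p i) := by
  classical
  have := Fintype.ofFinite α
  apply dense_of
  intro θ N x hx
  by_contra hcon
  push Not at hcon
  apply hp
  obtain ⟨s, hs⟩ := exists_bound.{u, v, 0, max u v} θ
  let S : Finset ℕ := insert 0 (s ∪ Finset.univ.image i)
  have hi : ∀ a, i a ∈ S := fun a => by simp [S]
  have h0 : 0 ∈ S := by simp [S]
  let g : ℕ → S := fun j => if h : j ∈ S then ⟨j, h⟩ else ⟨0, h0⟩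
  have hg : ∀ j (h : j ∈ S), g j = ⟨j, h⟩ := fun j h => by simp [g, h]
  let χ : L.Formula (α ⊕ S) := θ.relabel (fun j => Sum.inr (g j)) ⊓
    Formula.iInf fun a => Term.equal (Term.var (Sum.inl a)) (Term.var (Sum.inr (g (i a))))
  have hχ : ∀ (N : ModelType.{u, v, max u v} T) (y : α → N) (z : S → N),
      χ.Realize (Sum.elim y z) ↔ θ.Realize (z ∘ g) ∧ y = (z ∘ g) ∘ i := by
    intro N y z
    simp only [χ, Formula.realize_inf, Formula.realize_relabel, Formula.realize_iInf,
      Formula.realize_equal, Term.realize_var, Sum.elim_inl, Sum.elim_inr, funext_iff]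
    rfl
  have key : {p} = {q : T.CompleteType α | Has q (χ.iExs S)} := by
    apply Subset.antisymm
    · rintro _ rfl
      have h1 : T.typeOf (x ∘ i) = _ := not_omits fun h => hcon _ h ((has_typeOf _ _).2 hx)
      rw [Set.mem_ofPred_eq]
      rw [← h1, has_typeOf, Formula.realize_iExs]
      refine ⟨fun j => x j, (hχ _ _ _).2 ⟨hs N _ _ (fun a ha => ?_) hx, ?_⟩⟩
      · simp [hg a (by simp [S, ha])]
      · funext a
        simp [hg _ (hi a)]
    · intro q hq
      obtain ⟨N', y, rfl⟩ := exists_modelType_is_realized_in T q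
      rw [Set.mem_ofPred_eq] at hq
      rw [has_typeOf, Formula.realize_iExs] at hq
      obtain ⟨z, hz⟩ := hq
      obtain ⟨hz1, rfl⟩ := (hχ _ _ _).1 hz
      exact not_omits fun h => hcon _ h ((has_typeOf _ _).2 hz1)
  rw [key]
  exact isOpen_has _

/-- The omitting types theorem for a single type. -/
theorem omitting [Countable L.Symbols] {T : L.Theory} {α : Type} [Finite α]
    (p : T.CompleteType α) (hp : ¬ IsOpen {p}) :
    ∃ N : ModelType.{u, v, max u v} T, Countable N ∧ p ∉ T.realizedTypes N α := by
  have hsat : T.IsSatisfiable := CompleteType.nonempty_iff.1 ⟨p⟩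
  have hne : Nonempty (T.CompleteType ℕ) := CompleteType.nonempty_iff.2 hsat
  have hd : Dense (⋂ k : L.Formula (ℕ ⊕ Fin 1) ⊕ (α → ℕ),
      Sum.elim (henkin T) (omits p) k) := by
    apply dense_iInter_of_isOpen
    · rintro (φ | i)
      · exact henkin_open T φ
      · exact omits_open p i
    · rintro (φ | i)
      · exact henkin_dense_s7 T φ
      · exact omits_dense p hp i
  obtain ⟨r, hr⟩ := hd.nonempty
  rw [mem_iInter] at hr
  obtain ⟨N, x, rfl⟩ := exists_modelType_is_realized_in T r
  have hm : L.MeetsDefinable (range x) := by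
    intro D hD hdef
    obtain ⟨φ, hφ⟩ := Set.definable_iff_exists_formula_sum.1 hdef
    obtain ⟨d, hd⟩ := hD
    have hmem : ∀ c : N, c ∈ D ↔
        φ.Realize (Sum.elim ((↑) : range x → N) (fun _ : Fin 1 => c)) := fun c => by
      have := Set.ext_iff.1 hφ (fun _ => c)
      simpa using this
    choose idx hidx using fun c : range x => c.2
    have hc : ∀ c : Fin 1 → N, Sum.elim x c ∘ Sum.map idx id =
        Sum.elim ((↑) : range x → N) c := by
      intro c
      funext a
      rcases a with a | a <;> simp [hidx]
    rcases hr (Sum.inl (φ.relabel (Sum.map idx id))) with h | h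
    · exfalso
      rw [Set.mem_ofPred_eq] at h
      rw [has_typeOf, Formula.realize_not, Formula.realize_iExs] at h
      apply h
      refine ⟨fun _ => d, ?_⟩
      rw [Formula.realize_relabel, hc]
      exact (hmem d).1 hd
    · obtain ⟨k, hk⟩ := mem_iUnion.1 h
      rw [Set.mem_ofPred_eq] at hk
      rw [has_typeOf, Formula.realize_relabel, Formula.realize_relabel] at hk
      refine ⟨x k, (hmem _).2 ?_, ⟨k, rfl⟩⟩
      convert hk using 1
      rw [← hc]
      congr 1
      funext a
      rcases a with a | a <;> simp
  let S := hm.toElementarySubstructure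
  have hS : (S : Set N) = range x := hm.closure_eq_self
  refine ⟨S.toModel T, ?_, ?_⟩
  · change (S : Set N).Countable
    rw [hS]
    exact countable_range x
  · rintro ⟨y, rfl⟩
    let y' : α → S := y
    have : ∀ a, ∃ k, x k = (y' a : N) := fun a => by
      have h : (y' a : N) ∈ (S : Set N) := (y' a).2
      rw [hS] at h
      exact h
    choose i hi using this
    obtain ⟨ψ, hψ⟩ := mem_iUnion.1 (hr (Sum.inr i))
    rw [Set.mem_ofPred_eq] at hψ
    rw [has_typeOf, Formula.realize_relabel] at hψ
    apply ψ.2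
    rw [has_typeOf]
    refine (S.subtype.map_formula ψ.1 y').1 ?_
    convert hψ using 1
    funext a
    exact (hi a).symm

end RN
namespace RN
open FirstOrder.Language FirstOrder.Language.Theory Set

universe u v w w' x'
variable {L : FirstOrder.Language.{u, v}}

theorem completeTheory_equiv {M : Type w} [L.Structure M] {N : Type w'} [L.Structure N]
    (h : N ⊨ L.completeTheory M) : M ≅[L] N := by
  rw [elementarilyEquivalent_iff]
  intro φ
  constructor
  · intro hφ
    exact h.realize_of_mem φ hφ
  · intro hφ
    by_contra hn
    exact h.realize_of_mem φ.not hn hφ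

theorem exists_copy {M : Type w} [L.Structure M] [Infinite M] [Countable M] (T : L.Theory)
    [hT : M ⊨ T] : ∃ M' : ModelType.{u, v, x'} T, #M' = ℵ₀ ∧ Nonempty (M ≃[L] M') := by
  obtain ⟨e⟩ : Nonempty (M ≃ ULift.{x'} ℕ) := nonempty_equiv_of_countable
  let _ : L.Structure (ULift.{x'} ℕ) := e.inducedStructure
  let E : M ≃[L] ULift.{x'} ℕ := e.inducedStructureEquiv
  have : ULift.{x'} ℕ ⊨ T := StrongHomClass.theory_model E
  exact ⟨ModelType.of T (ULift.{x'} ℕ), by simp, ⟨E⟩⟩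

theorem cat_iso {M : Type w} [L.Structure M] [Countable M] [Infinite M]
    (hcat : Cardinal.Categorical (ℵ₀ : Cardinal.{x'}) (L.completeTheory M))
    (N : Type w') [L.Structure N] [Countable N] [hN : N ⊨ L.completeTheory M] :
    Nonempty (M ≃[L] N) := by
  have hinf : Infinite N := (completeTheory_equiv hN).infinite
  obtain ⟨M', h1, ⟨e1⟩⟩ := exists_copy.{u, v, w, x'} (M := M) (L.completeTheory M)
  obtain ⟨N', h2, ⟨e2⟩⟩ := exists_copy.{u, v, w', x'} (M := N) (L.completeTheory M)
  obtain ⟨e⟩ := hcat M' N' h1 h2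
  exact ⟨(e2.symm.comp e).comp e1⟩

theorem realized_of_iso {T : L.Theory} {M : Type w} [L.Structure M] [Nonempty M] [M ⊨ T]
    {N : Type w'} [L.Structure N] [Nonempty N] [N ⊨ T] (e : M ≃[L] N) {α : Type}
    (x : α → M) : T.typeOf (e ∘ x) = T.typeOf x := by
  apply has_ext
  intro φ
  rw [has_typeOf, has_typeOf, StrongHomClass.realize_formula]
  exact id

theorem isOpen_singleton [Countable L.Symbols] {M : Type w} [L.Structure M] [Countable M]
    [Infinite M] (hcat : Cardinal.Categorical (ℵ₀ : Cardinal.{x'}) (L.completeTheory M))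
    {α : Type} [Finite α] (p : (L.completeTheory M).CompleteType α) : IsOpen {p} := by
  by_contra hp
  obtain ⟨N, hN, hpN⟩ := omitting p hp
  apply hpN
  obtain ⟨K, x, rfl⟩ := exists_modelType_is_realized_in _ p
  have hK : Infinite K := (completeTheory_equiv K.is_model).infinite
  obtain ⟨S, hS1, hS2⟩ := exists_elementarySubstructure_card_eq L (range x)
    (ℵ₀ : Cardinal.{max u v}) le_rfl
    (by simpa using (countable_range x))
    (by simpa [Language.card] using (mk_le_aleph0 : #L.Symbols ≤ ℵ₀))
    (by simp)
  have hSc : Countable S := by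
    rw [← mk_le_aleph0_iff]
    simpa using hS2.le
  obtain ⟨e1⟩ := cat_iso hcat S
  obtain ⟨e2⟩ := cat_iso hcat N
  let y : α → S := fun a => ⟨x a, hS1 ⟨a, rfl⟩⟩
  refine ⟨(e2.comp e1.symm) ∘ y, ?_⟩
  rw [realized_of_iso]
  apply has_ext
  intro φ
  rw [has_typeOf, has_typeOf]
  intro h
  exact (S.subtype.map_formula φ y).2 h

theorem finite_types [Countable L.Symbols] {M : Type w} [L.Structure M] [Countable M]
    [Infinite M] (hcat : Cardinal.Categorical (ℵ₀ : Cardinal.{x'}) (L.completeTheory M))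
    (α : Type) [Finite α] : Finite ((L.completeTheory M).CompleteType α) := by
  have : DiscreteTopology ((L.completeTheory M).CompleteType α) :=
    discreteTopology_iff_isOpen_singleton.2 fun p => isOpen_singleton hcat p
  exact finite_of_compact_of_discrete

/-- `M` is atomic. -/
theorem atomic [Countable L.Symbols] {M : Type w} [L.Structure M] [Countable M]
    [Infinite M] (hcat : Cardinal.Categorical (ℵ₀ : Cardinal.{x'}) (L.completeTheory M))
    {α : Type w'} [Finite α] (a : α → M) : ∃ χ : L.Formula α, χ.Realize a ∧
      ∀ b : α → M, χ.Realize b → ∀ φ : L.Formula α, φ.Realize a ↔ φ.Realize b := by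
  obtain ⟨k, ⟨e⟩⟩ := Finite.exists_equiv_fin α
  obtain ⟨χ, h1, h2⟩ := exists_has_of_isOpen
    (isOpen_singleton hcat ((L.completeTheory M).typeOf (a ∘ e.symm))) rfl
  refine ⟨χ.relabel e.symm, ?_, fun b hb φ => ?_⟩
  · rwa [has_typeOf, ← Formula.realize_relabel] at h1
  · rw [Formula.realize_relabel, ← has_typeOf (T := L.completeTheory M)] at hb
    have h3 := h2 _ hb
    rw [mem_singleton_iff] at h3
    have h4 := has_typeOf (T := L.completeTheory M) (b ∘ e.symm) (φ.relabel e)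
    rw [h3, has_typeOf] at h4
    simpa [Formula.realize_relabel, Function.comp_assoc] using h4

/-- Finite partial elementary maps. -/
def Elem (L : FirstOrder.Language.{u, v}) {M : Type w} [L.Structure M] (s : Set (M × M)) : Prop :=
  ∀ (k : ℕ) (φ : L.Formula (Fin k)) (x : Fin k → M × M), (∀ i, x i ∈ s) →
    (φ.Realize (Prod.fst ∘ x) ↔ φ.Realize (Prod.snd ∘ x))

theorem Elem.swap {M : Type w} [L.Structure M] {s : Set (M × M)} (h : Elem L s) :
    Elem L (Prod.swap ⁻¹' s) := fun k φ x hx =>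
  (h k φ (Prod.swap ∘ x) hx).symm

theorem Elem.finite {M : Type w} [L.Structure M] {s : Set (M × M)} (h : Elem L s)
    {α : Type w'} [Finite α] (φ : L.Formula α) (x : α → M × M) (hx : ∀ i, x i ∈ s) :
    φ.Realize (Prod.fst ∘ x) ↔ φ.Realize (Prod.snd ∘ x) := by
  obtain ⟨k, ⟨e⟩⟩ := Finite.exists_equiv_fin α
  have := h k (φ.relabel e) (x ∘ e.symm) (fun i => hx _)
  simpa [Formula.realize_relabel, Function.comp_assoc] using this

theorem elem_range {M : Type w} [L.Structure M] {α : Type w'} (a b : α → M)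
    (h : ∀ φ : L.Formula α, φ.Realize a ↔ φ.Realize b) :
    Elem L (range fun i => (a i, b i)) := by
  intro k φ x hx
  choose j hj using hx
  have := h (φ.relabel j)
  rw [Formula.realize_relabel, Formula.realize_relabel] at this
  convert this using 2 <;> · funext i; simp [← hj]

theorem Elem.mono {M : Type w} [L.Structure M] {s t : Set (M × M)} (h : Elem L t) (hst : s ⊆ t) :
    Elem L s := fun k φ x hx => h k φ x fun i => hst (hx i)

theorem Elem.extend [Countable L.Symbols] {M : Type w} [L.Structure M] [Countable M]
    [Infinite M] (hcat : Cardinal.Categorical (ℵ₀ : Cardinal.{x'}) (L.completeTheory M))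
    {s : Set (M × M)} (hs : s.Finite) (h : Elem L s) (c : M) :
    ∃ d, Elem L (insert (c, d) s) := by
  have := hs.to_subtype
  obtain ⟨χ, h1, h2⟩ := atomic hcat (Sum.elim (fun i : s => i.1.1) (fun _ : Fin 1 => c))
  have h3 : (χ.iExs (Fin 1)).Realize (Prod.snd ∘ ((↑) : s → M × M)) := by
    rw [← h.finite _ _ (fun i => i.2), Formula.realize_iExs]
    exact ⟨_, h1⟩
  rw [Formula.realize_iExs] at h3
  obtain ⟨d, hd⟩ := h3
  refine ⟨d 0, (elem_range _ _ (h2 _ hd)).mono ?_⟩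
  rintro y (rfl | hy)
  · exact ⟨Sum.inr 0, rfl⟩
  · exact ⟨Sum.inl ⟨y, hy⟩, rfl⟩

/-- `M` is homogeneous. -/
theorem homogeneous [Countable L.Symbols] {M : Type w} [L.Structure M] [Countable M]
    [Infinite M] (hcat : Cardinal.Categorical (ℵ₀ : Cardinal.{x'}) (L.completeTheory M))
    {α : Type w'} [Finite α] (a b : α → M)
    (hab : ∀ φ : L.Formula α, φ.Realize a ↔ φ.Realize b) :
    ∃ π : M ≃[L] M, ⇑π ∘ a = b := by
  let P := {s : Set (M × M) // s.Finite ∧ Elem L s}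
  let C1 : M → Order.Cofinal P := fun m =>
    ⟨{s | ∃ d, (m, d) ∈ s.1}, fun s => by
      obtain ⟨d, hd⟩ := s.2.2.extend hcat s.2.1 m
      exact ⟨⟨_, s.2.1.insert _, hd⟩, ⟨d, mem_insert _ _⟩, subset_insert _ _⟩⟩
  let C2 : M → Order.Cofinal P := fun m =>
    ⟨{s | ∃ d, (d, m) ∈ s.1}, fun s => by
      obtain ⟨d, hd⟩ := s.2.2.swap.extend hcat
        (s.2.1.preimage Prod.swap_injective.injOn) m
      refine ⟨⟨insert (d, m) s.1, s.2.1.insert _, hd.swap.mono ?_⟩,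
        ⟨d, mem_insert _ _⟩, subset_insert _ _⟩
      rintro y (rfl | hy)
      · exact mem_insert _ _
      · exact Or.inr hy⟩
  let s0 : P := ⟨range fun i => (a i, b i), finite_range _, elem_range a b hab⟩
  have := Encodable.ofCountable (M ⊕ M)
  let I := Order.idealOfCofinals s0 (Sum.elim C1 C2)
  let R : Set (M × M) := ⋃ s ∈ I, s.1
  have hR : Elem L R := by
    intro k φ x hx
    have : ∀ i, ∃ s ∈ I, x i ∈ s.1 := fun i => by simpa [R] using hx i
    choose s hs hxs using this
    obtain ⟨t, ht, hst⟩ : ∃ t ∈ I, ∀ i, s i ≤ t := by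
      have hd : DirectedOn (· ≤ ·) (I : Set P) := I.directed
      have hd' : Directed (· ≤ ·) (fun y : (I : Set P) => y.1) := directedOn_iff_directed.1 hd
      have : Nonempty (I : Set P) := I.nonempty.to_subtype
      obtain ⟨t, ht⟩ := hd'.finite_le (fun i => ⟨s i, hs i⟩)
      exact ⟨t.1, t.2, ht⟩
    exact t.2.2 k φ x fun i => hst i (hxs i)
  have h0 : ∀ i, (a i, b i) ∈ R := fun i =>
    mem_iUnion₂.2 ⟨s0, Order.mem_idealOfCofinals _ _, ⟨i, rfl⟩⟩
  have hl : ∀ m, ∃ d, (m, d) ∈ R := fun m => by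
    obtain ⟨s, ⟨d, hd⟩, hs⟩ := Order.cofinal_meets_idealOfCofinals s0 (Sum.elim C1 C2) (Sum.inl m)
    exact ⟨d, mem_iUnion₂.2 ⟨s, hs, hd⟩⟩
  have hr : ∀ m, ∃ d, (d, m) ∈ R := fun m => by
    obtain ⟨s, ⟨d, hd⟩, hs⟩ := Order.cofinal_meets_idealOfCofinals s0 (Sum.elim C1 C2) (Sum.inr m)
    exact ⟨d, mem_iUnion₂.2 ⟨s, hs, hd⟩⟩
  have hfun : ∀ c d d', (c, d) ∈ R → (c, d') ∈ R → d = d' := by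
    intro c d d' h h'
    have := hR 2 (Term.equal (Term.var 0) (Term.var 1)) ![(c, d), (c, d')]
      (fun i => by fin_cases i <;> simpa)
    simpa [Formula.realize_equal] using this
  choose f hf using hl
  let F : M ↪ₑ[L] M := ⟨f, fun k φ x => (hR k φ (fun i => (x i, f (x i))) fun i => hf _).symm⟩
  have hsurj : Function.Surjective f := fun m => by
    obtain ⟨d, hd⟩ := hr m
    exact ⟨d, hfun _ _ _ (hf d) hd⟩
  refine ⟨⟨Equiv.ofBijective f ⟨F.injective, hsurj⟩, fun g x => F.map_fun g x,
    fun r x => F.map_rel r x⟩, ?_⟩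
  funext i
  exact hfun _ _ _ (hf _) (h0 i)

end RN

/-- Over a countably infinite structure `M` over a countable language with ℵ₀-categorical
complete theory, every set definable with parameters from a finite set `A` is a finite union
of orbits of the group of automorphisms of `M` fixing `A` pointwise. -/
theorem stmt_7 (L : FirstOrder.Language) [Countable L.Symbols]
    (M : Type*) [L.Structure M] [Countable M] [Infinite M]
    (hcat : Cardinal.Categorical ℵ₀ (L.completeTheory M))
    (A : Set M) (hA : A.Finite) (n : ℕ) (X : Set (Fin n → M))
    (hX : Set.Definable A L X) :
    ∃ s : Finset (Fin n → M), ↑s ⊆ X ∧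
      X = ⋃ a ∈ s, {b : Fin n → M | ∃ π : M ≃[L] M, (∀ c ∈ A, π c = c) ∧ ⇑π ∘ a = b} := by
  classical
  have := hA.to_subtype
  obtain ⟨k, ⟨e⟩⟩ := Finite.exists_equiv_fin (A ⊕ Fin n)
  have hfin := RN.finite_types hcat (Fin k)
  let E : (Fin n → M) → (A ⊕ Fin n) → M := fun a => Sum.elim (↑) a
  let τ : (Fin n → M) → (L.completeTheory M).CompleteType (Fin k) := fun a =>
    (L.completeTheory M).typeOf (E a ∘ e.symm)
  obtain ⟨t, htX, htf, hτ⟩ : ∃ t ⊆ X, t.Finite ∧ τ '' t = τ '' X := by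
    obtain ⟨t, ht, h⟩ := Set.exists_subset_bijOn X τ
    refine ⟨t, ht, Set.Finite.of_finite_image (Set.toFinite (τ '' t)) h.injOn, h.image_eq⟩
  refine ⟨htf.toFinset, by simpa using htX, Set.Subset.antisymm ?_ ?_⟩
  · intro b hb
    obtain ⟨a, ha, hab⟩ : τ b ∈ τ '' t := hτ ▸ Set.mem_image_of_mem τ hb
    obtain ⟨π, hπ⟩ := RN.homogeneous hcat (E a) (E b) (fun φ => by
      have h1 := RN.has_typeOf (T := L.completeTheory M) (E a ∘ e.symm) (φ.relabel e)
      have h2 := RN.has_typeOf (T := L.completeTheory M) (E b ∘ e.symm) (φ.relabel e)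
      have h3 := h1.symm.trans ((iff_of_eq (congrArg (fun p => RN.Has p _) hab)).trans h2)
      simpa [Language.Formula.realize_relabel, Function.comp_assoc] using h3)
    refine Set.mem_iUnion₂.2 ⟨a, by simpa using ha, π, fun c hc => ?_, ?_⟩
    · exact congrFun hπ (Sum.inl ⟨c, hc⟩)
    · funext i
      exact congrFun hπ (Sum.inr i)
  · intro b hb
    obtain ⟨a, ha, π, hπ, rfl⟩ := Set.mem_iUnion₂.1 hb
    have haX : a ∈ X := htX (by simpa using ha)
    obtain ⟨φ, rfl⟩ := Set.definable_iff_exists_formula_sum.1 hX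
    rw [Set.mem_ofPred_eq] at haX ⊢
    rw [← Language.StrongHomClass.realize_formula π φ] at haX
    convert haX using 1
    funext i
    rcases i with i | i
    · exact (hπ _ i.2).symm
    · rfl
end

section
/- Let L be a countable first-order language and M a countably infinite L-structure whose complete theory is ℵ₀-categorical. Let A ⊆ M be a finite set and f : (Fin n → M) → (Fin m → M) a function that commutes with every automorphism of M fixing A pointwise (i.e., f(π ∘ x) = π ∘ f(x) for every such automorphism π and every x). Then the graph of f, viewed as a subset of (Fin n ⊕ Fin m → M), is definable in L with parameters from A. -/
open FirstOrder Cardinal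

namespace RN
open FirstOrder.Language Set Theory CompleteType

universe u v w w' w₂ w₃

/-- The basic clopen set of a formula. -/
def U {L : FirstOrder.Language.{u, v}} (T : L.Theory) {α : Type w} (ψ : L.Formula α) :
    Set (T.CompleteType α) := T.typesWith (Formula.equivSentence ψ)

section
variable {L : FirstOrder.Language.{u, v}} {T : L.Theory} {α : Type w}

theorem isOpen_U (ψ : L.Formula α) : IsOpen (U T ψ) := _root_.CompleteType.isOpen_typesWith _

theorem typeOf_mem_U {N : Type w'} [L.Structure N] [Nonempty N] [N ⊨ T]
    (x : α → N) (ψ : L.Formula α) : T.typeOf x ∈ U T ψ ↔ ψ.Realize x :=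
  formula_mem_typeOf

theorem U_not (ψ : L.Formula α) : U T ψ.not = (U T ψ)ᶜ := by
  ext q
  obtain ⟨N, y, rfl⟩ := exists_modelType_is_realized_in T q
  rw [mem_compl_iff, typeOf_mem_U, typeOf_mem_U, Formula.realize_not]

theorem exists_U {q : T.CompleteType α} {O : Set (T.CompleteType α)} (hO : IsOpen O)
    (hq : q ∈ O) : ∃ ψ : L.Formula α, q ∈ U T ψ ∧ U T ψ ⊆ O := by
  obtain ⟨_, ⟨φ, rfl⟩, h1, h2⟩ :=
    _root_.CompleteType.isTopologicalBasis_range_typesWith.exists_subset_of_mem_open hq hO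
  refine ⟨Formula.equivSentence.symm φ, ?_, ?_⟩ <;> simpa [U]

theorem typeOf_eq_iff {N : Type w'} [L.Structure N] [Nonempty N] [N ⊨ T]
    {N' : Type w₂} [L.Structure N'] [Nonempty N'] [N' ⊨ T]
    (x : α → N) (y : α → N') :
    T.typeOf x = T.typeOf y ↔ ∀ ψ : L.Formula α, ψ.Realize x ↔ ψ.Realize y := by
  constructor
  · intro h ψ
    rw [← typeOf_mem_U (T := T), h, typeOf_mem_U]
  · intro h
    refine SetLike.ext fun φ => ?_
    rw [mem_typeOf, mem_typeOf, h]

theorem formula_bound (θ : L.Formula ℕ) : ∃ K : ℕ, ∀ (N : Type w') [L.Structure N]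
    (x y : ℕ → N), (∀ i < K, x i = y i) → (θ.Realize x ↔ θ.Realize y) := by
  classical
  refine ⟨(BoundedFormula.freeVarFinset θ).sup id + 1, fun N _ x y h => ?_⟩
  have h1 := BoundedFormula.realize_restrictFreeVar (M := N) (φ := θ) (f := fun a => (a : ℕ))
    (v := x) (xs := default) x (fun _ => rfl)
  have h2 := BoundedFormula.realize_restrictFreeVar (M := N) (φ := θ) (f := fun a => (a : ℕ))
    (v := x) (xs := default) y (fun a => h _ (Nat.lt_succ_of_le (Finset.le_sup (f := id) a.2)))
  exact h1.symm.trans h2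

/-- Henkin set. -/
def D (T : L.Theory) (θ : L.Formula (ℕ ⊕ Fin 1)) : Set (T.CompleteType ℕ) :=
  U T (θ.iExs (Fin 1)).not ∪ ⋃ i : ℕ, U T (θ.relabel (Sum.elim id fun _ => i))

theorem isOpen_D (θ : L.Formula (ℕ ⊕ Fin 1)) : IsOpen (D T θ) :=
  (isOpen_U _).union (isOpen_iUnion fun _ => isOpen_U _)

theorem dense_D (θ : L.Formula (ℕ ⊕ Fin 1)) : Dense (D T θ) := by
  rw [dense_iff_inter_open]
  rintro O hO ⟨q, hq⟩
  obtain ⟨ψ, hqψ, hψ⟩ := exists_U hO hq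
  obtain ⟨N, y, rfl⟩ := exists_modelType_is_realized_in T q
  rw [typeOf_mem_U] at hqψ
  by_cases hex : (θ.iExs (Fin 1)).Realize y
  · have hex' := hex
    rw [Formula.realize_iExs] at hex
    obtain ⟨b, hb⟩ := hex
    obtain ⟨K₁, h₁⟩ := formula_bound ψ
    obtain ⟨K₂, h₂⟩ := formula_bound (θ.relabel (β := ℕ)
      (Sum.elim (fun i => i + 1) (fun _ => 0)))
    have hb' := (h₂ N (fun i => Nat.casesOn i (b 0) y)
      (fun i => Nat.casesOn i (b 0) (Function.update y (max K₁ K₂) (b 0))) (by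
        rintro (_ | i) hi
        · rfl
        · have : i ≠ max K₁ K₂ := by omega
          simp [Function.update_of_ne this]))
    rw [Formula.realize_relabel, Formula.realize_relabel] at hb'
    refine ⟨T.typeOf (Function.update y (max K₁ K₂) (b 0)), hψ ?_, Or.inr ?_⟩
    · rw [typeOf_mem_U]
      refine (h₁ N _ _ fun i hi => ?_).1 hqψ
      have : i ≠ max K₁ K₂ := by omega
      simp [Function.update_of_ne this]
    · rw [mem_iUnion]
      refine ⟨max K₁ K₂, ?_⟩
      rw [typeOf_mem_U, Formula.realize_relabel]
      convert! hb'.1 _ using 1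
      · funext i
        rcases i with i | i <;> simp
      · convert! hb using 1
        funext i
        rcases i with i | i
        · simp
        · simp [Subsingleton.elim i 0]
  · exact ⟨_, hψ ((typeOf_mem_U _ _).2 hqψ), Or.inl ((typeOf_mem_U _ _).2 hex)⟩

/-- Omission set. -/
def E {k : ℕ} (p : T.CompleteType (Fin k)) (x : Fin k → ℕ) : Set (T.CompleteType ℕ) :=
  ⋃ ψ : {ψ : L.Formula (Fin k) // p ∈ U T ψ}, U T (ψ.1.relabel x).not

theorem isOpen_E {k : ℕ} (p : T.CompleteType (Fin k)) (x : Fin k → ℕ) : IsOpen (E p x) :=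
  isOpen_iUnion fun _ => isOpen_U _

theorem typeOf_mem_E {k : ℕ} (p : T.CompleteType (Fin k)) (x : Fin k → ℕ)
    {N : Type w'} [L.Structure N] [Nonempty N] [N ⊨ T] (y : ℕ → N) :
    T.typeOf y ∈ E p x ↔ T.typeOf (y ∘ x) ≠ p := by
  obtain ⟨N', y', rfl⟩ := exists_modelType_is_realized_in T p
  rw [Ne, typeOf_eq_iff]
  simp only [E, mem_iUnion, Subtype.exists, typeOf_mem_U, Formula.realize_not,
    Formula.realize_relabel, exists_prop]
  constructor
  · rintro ⟨ψ, h1, h2⟩ h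
    exact h2 ((h ψ).2 h1)
  · intro h
    by_contra! hc
    refine h fun ψ => ⟨fun h1 => ?_, hc ψ⟩
    by_contra h2
    exact hc ψ.not h2 h1

theorem dense_E {k : ℕ} (p : T.CompleteType (Fin k)) (hp : ¬ IsOpen {p}) (x : Fin k → ℕ) :
    Dense (E p x) := by
  rw [dense_iff_inter_open]
  rintro O hO ⟨q, hq⟩
  by_contra hne
  have hall : ∀ q ∈ O, q ∉ E p x := fun q h1 h2 => hne ⟨q, h1, h2⟩
  obtain ⟨θ, hqθ, hθ⟩ := exists_U hO hq
  obtain ⟨K, hK⟩ := formula_bound θ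
  let K' := K + Finset.univ.sup x + 1
  have hx : ∀ i, x i < K' := fun i => by
    have := Finset.le_sup (f := x) (Finset.mem_univ i)
    omega
  let g : ℕ → Fin K' := fun i => if h : i < K' then ⟨i, h⟩ else ⟨0, by omega⟩
  let χ : L.Formula (Fin k) := Formula.iExs (Fin K')
    (θ.relabel (fun i => Sum.inr (g i)) ⊓
      Formula.iInf fun i : Fin k => (Term.var (Sum.inl i)).equal (Term.var (Sum.inr (g (x i)))))
  have hχ : ∀ (N : Type (max u v)) [L.Structure N] (y : Fin k → N), χ.Realize y ↔
      ∃ w : Fin K' → N, θ.Realize (w ∘ g) ∧ ∀ i, y i = w (g (x i)) := by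
    intro N _ y
    simp only [χ, Formula.realize_iExs, Formula.realize_inf, Formula.realize_relabel,
      Formula.realize_iInf, Formula.realize_equal, Term.realize_var, Sum.elim_inl, Sum.elim_inr]
    rfl
  apply hp
  convert! isOpen_U (T := T) χ
  refine Subset.antisymm (singleton_subset_iff.2 ?_) ?_
  · have h := hall q hq
    obtain ⟨N, y, rfl⟩ := exists_modelType_is_realized_in T q
    rw [typeOf_mem_E, not_not] at h
    rw [← h, typeOf_mem_U, hχ]
    refine ⟨fun i => y i, (hK N _ _ fun i hi => ?_).1 ((typeOf_mem_U _ _).1 hqθ), fun i => ?_⟩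
    · have : i < K' := by omega
      simp [g, this]
    · simp [g, hx]
  · intro r hr
    obtain ⟨N, y, rfl⟩ := exists_modelType_is_realized_in T r
    rw [typeOf_mem_U, hχ] at hr
    obtain ⟨z, hz, hy⟩ := hr
    have h := hall (T.typeOf (z ∘ g)) (hθ ((typeOf_mem_U _ _).2 hz))
    rw [typeOf_mem_E, not_not] at h
    rw [mem_singleton_iff, ← h]
    congr 1
    exact funext hy

theorem countable_formula [Countable L.Symbols] (α : Type w) [Countable α] :
    Countable (L.Formula α) := by
  have h := BoundedFormula.card_le (L := L) (α := α)
  have hL : L.card ≤ ℵ₀ := Cardinal.mk_le_aleph0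
  have : #(Σ n, L.BoundedFormula α n) ≤ ℵ₀ := by
    refine h.trans (max_le le_rfl (Cardinal.add_le_aleph0.2 ⟨?_, ?_⟩))
    · simp
    · simpa using hL
  have : Countable (Σ n, L.BoundedFormula α n) := Cardinal.mk_le_aleph0_iff.1 this
  exact Function.Injective.countable (f := fun φ : L.Formula α => (⟨0, φ⟩ : Σ n, L.BoundedFormula α n))
    (fun a b h => by simpa using h)

theorem omitting_s8 [Countable L.Symbols] (hT : T.IsSatisfiable) {k : ℕ}
    (p : T.CompleteType (Fin k)) (hp : ¬ IsOpen {p}) :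
    ∃ (N : Type (max u v)) (_ : L.Structure N) (_ : Nonempty N) (_ : N ⊨ T),
      Countable N ∧ ∀ y : Fin k → N, T.typeOf y ≠ p := by
  have : Countable (L.Formula (ℕ ⊕ Fin 1)) := countable_formula _
  have hne : Nonempty (T.CompleteType ℕ) := CompleteType.nonempty_iff.2 hT
  have hd : Dense (⋂ s : L.Formula (ℕ ⊕ Fin 1) ⊕ (Fin k → ℕ),
      Sum.elim (D T) (E p) s) := by
    apply dense_iInter_of_isOpen
    · rintro (θ | x)
      · exact isOpen_D θ
      · exact isOpen_E p x
    · rintro (θ | x)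
      · exact dense_D θ
      · exact dense_E p hp x
  obtain ⟨q, hq⟩ := hd.nonempty
  obtain ⟨N, y, rfl⟩ := exists_modelType_is_realized_in T q
  rw [mem_iInter] at hq
  have hm : L.MeetsDefinable (range y) := by
    rintro S ⟨a, ha⟩ hS
    obtain ⟨φ, hφ⟩ := definable_iff_exists_formula_sum.1 hS
    choose c hc using fun a : range y => a.2
    have hφ' : ∀ a : N, a ∈ S ↔ φ.Realize (Sum.elim (fun a : range y => (a : N)) fun _ => a) := by
      intro a
      have := Set.ext_iff.1 hφ (fun _ => a)
      simpa using this
    have key : ∀ (g : Fin 1 → N), (φ.relabel (Sum.map c id)).Realize (Sum.elim y g) ↔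
        g 0 ∈ S := by
      intro g
      rw [Formula.realize_relabel, hφ']
      convert! Iff.rfl using 2
      funext i
      rcases i with i | i
      · simp [hc]
      · simp [Subsingleton.elim i 0]
    rcases hq (Sum.inl (φ.relabel (Sum.map c id))) with h | h
    · rw [typeOf_mem_U, Formula.realize_not, Formula.realize_iExs] at h
      exact absurd ⟨fun _ => a, (key _).2 ha⟩ h
    · obtain ⟨i, h⟩ := mem_iUnion.1 h
      rw [typeOf_mem_U, Formula.realize_relabel] at h
      refine ⟨y i, (key fun _ => y i).1 ?_, mem_range_self i⟩
      convert! h using 1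
      funext j
      rcases j with j | j <;> rfl
  let S := hm.toElementarySubstructure
  have hS : (S : Set N) = range y := hm.closure_eq_self
  refine ⟨S, inferInstance, ⟨⟨y 0, ?_⟩⟩, inferInstance, ?_, ?_⟩
  · rw [← SetLike.mem_coe, hS]; exact mem_range_self 0
  · have : (S : Set N).Countable := hS ▸ countable_range y
    exact this.to_subtype
  · intro z hz
    have : ∀ i, ∃ n, y n = z i := fun i => by
      have := (z i).2
      rwa [← SetLike.mem_coe, hS] at this
    choose x hx using this
    have h := hq (Sum.inr x)
    rw [Sum.elim_inr, typeOf_mem_E] at h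
    apply h
    rw [← hz, typeOf_eq_iff]
    intro ψ
    rw [← S.subtype.map_formula]
    convert! Iff.rfl using 2
    funext i
    exact (hx i).symm

end
end RN

namespace RN
open FirstOrder.Language Set Theory CompleteType

universe u v w w' w₂ w₃

section
variable {L : FirstOrder.Language.{u, v}} {T : L.Theory}

theorem to_ulift (hcat : Cardinal.Categorical.{u, v, w} ℵ₀ T)
    (N₁ : Type w₂) [L.Structure N₁] [N₁ ⊨ T] [Countable N₁] [Infinite N₁]
    (N₂ : Type w₃) [L.Structure N₂] [N₂ ⊨ T] [Countable N₂] [Infinite N₂] :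
    Nonempty (N₁ ≃[L] N₂) := by
  obtain ⟨e₁⟩ : Nonempty (N₁ ≃ ℕ) := nonempty_equiv_of_countable
  obtain ⟨e₂⟩ : Nonempty (N₂ ≃ ℕ) := nonempty_equiv_of_countable
  let e₁' : N₁ ≃ ULift.{w} ℕ := e₁.trans Equiv.ulift.symm
  let e₂' : N₂ ≃ ULift.{w} ℕ := e₂.trans Equiv.ulift.symm
  let M₁ : T.ModelType := ModelType.equivInduced (M := ModelType.of T N₁) e₁'
  let M₂ : T.ModelType := ModelType.equivInduced (M := ModelType.of T N₂) e₂'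
  have h₁ : #M₁ = ℵ₀ := by
    change #(ULift.{w} ℕ) = ℵ₀
    simp
  have h₂ : #M₂ = ℵ₀ := by
    change #(ULift.{w} ℕ) = ℵ₀
    simp
  obtain ⟨f⟩ := hcat M₁ M₂ h₁ h₂
  let i₁ : N₁ ≃[L] M₁ := e₁'.inducedStructureEquiv
  let i₂ : N₂ ≃[L] M₂ := e₂'.inducedStructureEquiv
  exact ⟨i₂.symm.comp (f.comp i₁)⟩

theorem isolated_s8 [Countable L.Symbols] (hcat : Cardinal.Categorical.{u, v, w} ℵ₀ T)
    (hinf : ∀ (N : Type (max u v)) [L.Structure N] [Nonempty N] [N ⊨ T], Infinite N)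
    {k : ℕ} (p : T.CompleteType (Fin k)) : IsOpen {p} := by
  by_contra hp
  obtain ⟨N', y, hy⟩ := exists_modelType_is_realized_in T p
  have hsat : T.IsSatisfiable := ⟨N'⟩
  obtain ⟨N, _, _, _, _, hN⟩ := omitting_s8 hsat p hp
  have := hinf N
  have := hinf N'
  obtain ⟨S, hS, hcard⟩ := exists_elementarySubstructure_card_eq L (M := N') (range y) (ℵ₀ : Cardinal.{0}) le_rfl
    (by simpa using (countable_range y).le_aleph0)
    (by
      have hL : L.card ≤ ℵ₀ := Cardinal.mk_le_aleph0
      simpa using hL) (by simp)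
  have hcard : #S = ℵ₀ := by simpa using hcard
  have : Countable S := Cardinal.mk_le_aleph0_iff.1 hcard.le
  have : Infinite S := Cardinal.infinite_iff.2 hcard.ge
  obtain ⟨f⟩ := to_ulift hcat S N
  let z : Fin k → S := fun i => ⟨y i, hS (mem_range_self i)⟩
  apply hN (f ∘ z)
  rw [← hy, typeOf_eq_iff]
  intro ψ
  rw [StrongHomClass.realize_formula, ← S.subtype.map_formula]
  rfl

theorem finite_types_s8 [Countable L.Symbols] (hcat : Cardinal.Categorical.{u, v, w} ℵ₀ T)
    (hinf : ∀ (N : Type (max u v)) [L.Structure N] [Nonempty N] [N ⊨ T], Infinite N)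
    (k : ℕ) : Finite (T.CompleteType (Fin k)) := by
  have : DiscreteTopology (T.CompleteType (Fin k)) :=
    discreteTopology_iff_isOpen_singleton.2 (isolated_s8 hcat hinf)
  exact finite_of_compact_of_discrete

end

section
variable (L : FirstOrder.Language.{u, v}) {M : Type w'} [L.Structure M]

/-- Partial elementary relations. -/
def PE (s : Set (M × M)) : Prop :=
  ∀ (k : ℕ) (φ : L.Formula (Fin k)) (c : Fin k → M × M), (∀ i, c i ∈ s) →
    (φ.Realize (fun i => (c i).1) ↔ φ.Realize (fun i => (c i).2))

variable {L}

theorem pe_range {k : ℕ} (c : Fin k → M × M) (h : ∀ φ : L.Formula (Fin k),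
    φ.Realize (fun i => (c i).1) ↔ φ.Realize (fun i => (c i).2)) : PE L (range c) := by
  intro n φ d hd
  choose g hg using hd
  have := h (φ.relabel g)
  rw [Formula.realize_relabel, Formula.realize_relabel] at this
  simpa only [Function.comp_def, hg] using this

theorem pe_swap {s : Set (M × M)} (h : PE L s) : PE L (Prod.swap '' s) := by
  intro n φ d hd
  have := h n φ (fun i => (d i).swap) (fun i => by
    obtain ⟨a, ha, h⟩ := hd i
    rw [← h]; simpa using ha)
  exact this.symm

theorem pe_extend
    (hiso : ∀ (k : ℕ) (a : Fin k → M), ∃ φ : L.Formula (Fin k), φ.Realize a ∧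
      ∀ b : Fin k → M, φ.Realize b → ∀ ψ : L.Formula (Fin k), ψ.Realize a ↔ ψ.Realize b)
    {s : Set (M × M)} (hs : s.Finite) (h : PE L s) (m : M) :
    ∃ m', PE L (insert (m, m') s) := by
  obtain ⟨k, c, rfl⟩ : ∃ (k : ℕ) (c : Fin k → M × M), range c = s := by
    obtain ⟨k, f, hf, h⟩ := hs.fin_param
    exact ⟨k, f, h⟩
  obtain ⟨φ, h1, h2⟩ := hiso (k + 1) (Fin.cons m fun i => (c i).1)
  let θ : L.Formula (Fin k) := (φ.relabel (Fin.cons (Sum.inr 0) Sum.inl)).iExs (Fin 1)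
  have hθ : ∀ a : Fin k → M, θ.Realize a ↔ ∃ b, φ.Realize (Fin.cons b a : Fin (k + 1) → M) := by
    intro a
    have key : ∀ g : Fin 1 → M, (Sum.elim a g) ∘ (Fin.cons (Sum.inr 0) Sum.inl :
        Fin (k + 1) → Fin k ⊕ Fin 1) = (Fin.cons (g 0) a : Fin (k + 1) → M) := by
      intro g
      funext i
      cases i using Fin.cases <;> simp
    simp only [θ, Formula.realize_iExs, Formula.realize_relabel, key]
    exact ⟨fun ⟨g, hg⟩ => ⟨_, hg⟩, fun ⟨b, hb⟩ => ⟨fun _ => b, hb⟩⟩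
  have h3 := (h k θ c (fun i => mem_range_self i)).1 ((hθ _).2 ⟨m, h1⟩)
  obtain ⟨m', hm'⟩ := (hθ _).1 h3
  refine ⟨m', ?_⟩
  have h4 := pe_range (L := L) (Fin.cons (m, m') c : Fin (k + 1) → M × M) (fun ψ => by
    have := h2 _ hm' ψ
    convert! this using 2
    · funext i; cases i using Fin.cases <;> simp
    · funext i; cases i using Fin.cases <;> simp)
  rwa [Fin.range_cons] at h4

theorem pe_step
    (hiso : ∀ (k : ℕ) (a : Fin k → M), ∃ φ : L.Formula (Fin k), φ.Realize a ∧
      ∀ b : Fin k → M, φ.Realize b → ∀ ψ : L.Formula (Fin k), ψ.Realize a ↔ ψ.Realize b)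
    (m : M) (s : {s : Set (M × M) // s.Finite ∧ PE L s}) :
    ∃ t : {s : Set (M × M) // s.Finite ∧ PE L s},
      s.1 ⊆ t.1 ∧ (∃ m', (m, m') ∈ t.1) ∧ ∃ m', (m', m) ∈ t.1 := by
  obtain ⟨s, hs, h⟩ := s
  obtain ⟨m₁, h₁⟩ := pe_extend hiso hs h m
  obtain ⟨m₂, h₂⟩ := pe_extend hiso ((hs.insert _).image Prod.swap) (pe_swap h₁) m
  have h₃ := pe_swap h₂
  refine ⟨⟨_, (((hs.insert _).image Prod.swap).insert _).image Prod.swap, h₃⟩, ?_, ⟨m₁, ?_⟩,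
    ⟨m₂, ?_⟩⟩
  · rintro ⟨a, b⟩ hab
    simp [hab]
  · simp
  · simp

theorem exists_auto [Countable M]
    (hiso : ∀ (k : ℕ) (a : Fin k → M), ∃ φ : L.Formula (Fin k), φ.Realize a ∧
      ∀ b : Fin k → M, φ.Realize b → ∀ ψ : L.Formula (Fin k), ψ.Realize a ↔ ψ.Realize b)
    {k : ℕ} (a b : Fin k → M) (hab : ∀ ψ : L.Formula (Fin k), ψ.Realize a ↔ ψ.Realize b) :
    ∃ π : M ≃[L] M, π ∘ a = b := by
  rcases isEmpty_or_nonempty M with hM | hM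
  · exact ⟨Language.Equiv.refl L M, funext fun i => (hM.false (a i)).elim⟩
  obtain ⟨e, he⟩ := exists_surjective_nat M
  choose step hstep using pe_step (L := L) hiso
  let s₀ : {s : Set (M × M) // s.Finite ∧ PE L s} :=
    ⟨range fun i => (a i, b i), finite_range _, pe_range _ hab⟩
  let S : ℕ → {s : Set (M × M) // s.Finite ∧ PE L s} :=
    fun n => Nat.rec s₀ (fun n s => step (e n) s) n
  have hmono : Monotone fun n => (S n).1 :=
    monotone_nat_of_le_succ fun n => (hstep (e n) (S n)).1
  let G : Set (M × M) := ⋃ n, (S n).1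
  have hG : PE L G := by
    intro n φ c hc
    choose g hg using fun i => mem_iUnion.1 (hc i)
    exact (S (Finset.univ.sup g)).2.2 n φ c fun i =>
      hmono (Finset.le_sup (f := g) (Finset.mem_univ i)) (hg i)
  have hl : ∀ m, ∃ m', (m, m') ∈ G := fun m => by
    obtain ⟨n, rfl⟩ := he m
    obtain ⟨m', h⟩ := (hstep (e n) (S n)).2.1
    exact ⟨m', mem_iUnion.2 ⟨n + 1, h⟩⟩
  have hr : ∀ m, ∃ m', (m', m) ∈ G := fun m => by
    obtain ⟨n, rfl⟩ := he m
    obtain ⟨m', h⟩ := (hstep (e n) (S n)).2.2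
    exact ⟨m', mem_iUnion.2 ⟨n + 1, h⟩⟩
  have heq : ∀ x y x' y', (x, x') ∈ G → (y, y') ∈ G → (x = y ↔ x' = y') := by
    intro x y x' y' h1 h2
    have := hG 2 ((Term.var 0).equal (Term.var 1)) ![(x, x'), (y, y')] (fun i => by
      fin_cases i <;> simpa)
    simpa [Formula.realize_equal] using this
  choose f hf using hl
  choose g hg using hr
  let E : M ≃ M :=
    { toFun := f
      invFun := g
      left_inv := fun x => (heq _ _ _ _ (hg (f x)) (hf x)).2 rfl
      right_inv := fun x => (heq _ _ _ _ (hf (g x)) (hg x)).1 rfl }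
  refine ⟨⟨E, ?_, ?_⟩, ?_⟩
  · intro n F x
    change f (Structure.funMap F x) = Structure.funMap F (f ∘ x)
    have := hG (n + 1) ((Term.var 0).equal (Term.func F fun i => Term.var i.succ))
      (Fin.cons (Structure.funMap F x, f (Structure.funMap F x)) fun i => (x i, f (x i)))
      (fun i => by cases i using Fin.cases <;> simp [hf])
    simpa [Formula.realize_equal, Function.comp_def] using this
  · intro n R x
    change Structure.RelMap R (f ∘ x) ↔ Structure.RelMap R x
    have := hG n (R.formula fun i => Term.var i) (fun i => (x i, f (x i))) (fun i => hf _)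
    simpa [Formula.realize_rel, Function.comp_def] using this.symm
  · funext i
    change f (a i) = b i
    exact (heq _ _ _ _ (hf (a i)) (mem_iUnion.2 ⟨0, mem_range_self i⟩)).1 rfl

end

theorem invariant_definable {L : FirstOrder.Language.{u, v}} [Countable L.Symbols]
    {M : Type w'} [L.Structure M] [Countable M] [Infinite M]
    (hcat : Cardinal.Categorical.{u, v, w} ℵ₀ (L.completeTheory M))
    (k : ℕ) (S : Set (Fin k → M)) (hS : ∀ (π : M ≃[L] M), ∀ x ∈ S, π ∘ x ∈ S) :
    ∃ φ : L.Formula (Fin k), ∀ x, x ∈ S ↔ φ.Realize x := by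
  let T := L.completeTheory M
  have hinf : ∀ (N : Type (max u v)) [L.Structure N] [Nonempty N] [N ⊨ T], Infinite N := by
    intro N _ _ _
    have h : M ≅[L] N :=
      ((completeTheory.isComplete L M).eq_complete_theory M).symm.trans
        ((completeTheory.isComplete L M).eq_complete_theory N)
    exact h.infinite
  have hiso' : ∀ (k : ℕ) (p : T.CompleteType (Fin k)), ∃ φ : L.Formula (Fin k), U T φ = {p} := by
    intro k p
    obtain ⟨φ, h1, h2⟩ := exists_U (isolated_s8 hcat hinf p) rfl
    exact ⟨φ, h2.antisymm (singleton_subset_iff.2 h1)⟩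
  have hiso : ∀ (k : ℕ) (a : Fin k → M), ∃ φ : L.Formula (Fin k), φ.Realize a ∧
      ∀ b : Fin k → M, φ.Realize b → ∀ ψ : L.Formula (Fin k), ψ.Realize a ↔ ψ.Realize b := by
    intro k a
    obtain ⟨φ, hφ⟩ := hiso' k (T.typeOf a)
    have key : ∀ b : Fin k → M, φ.Realize b ↔ T.typeOf b = T.typeOf a := by
      intro b
      rw [← typeOf_mem_U (T := T), hφ, mem_singleton_iff]
    refine ⟨φ, (key a).2 rfl, fun b hb => ?_⟩
    exact (typeOf_eq_iff _ _).1 ((key b).1 hb).symm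
  have := finite_types_s8 hcat hinf k
  choose F hF using hiso' k
  let P : Set (T.CompleteType (Fin k)) := T.typeOf '' S
  refine ⟨Formula.iSup (fun p : P => F p), fun x => ?_⟩
  simp only [Formula.realize_iSup]
  have key : ∀ p, (F p).Realize x ↔ T.typeOf x = p := by
    intro p
    rw [← typeOf_mem_U (T := T), hF, mem_singleton_iff]
  simp only [key]
  constructor
  · intro hx
    exact ⟨⟨_, mem_image_of_mem _ hx⟩, rfl⟩
  · rintro ⟨⟨_, y, hy, rfl⟩, h⟩
    obtain ⟨π, rfl⟩ := exists_auto hiso y x ((typeOf_eq_iff _ _).1 h.symm)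
    exact hS π y hy

theorem invariant_definable' {L : FirstOrder.Language.{u, v}} [Countable L.Symbols]
    {M : Type w'} [L.Structure M] [Countable M] [Infinite M]
    (hcat : Cardinal.Categorical.{u, v, w} ℵ₀ (L.completeTheory M))
    {α : Type w₂} [Finite α] (S : Set (α → M)) (hS : ∀ (π : M ≃[L] M), ∀ x ∈ S, π ∘ x ∈ S) :
    ∃ φ : L.Formula α, ∀ x, x ∈ S ↔ φ.Realize x := by
  obtain ⟨k, ⟨e⟩⟩ := Finite.exists_equiv_fin α
  obtain ⟨φ, hφ⟩ := invariant_definable hcat k {x | x ∘ e ∈ S} (fun π x hx => hS π _ hx)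
  refine ⟨φ.relabel e.symm, fun x => ?_⟩
  rw [Formula.realize_relabel, ← hφ]
  simp [Function.comp_assoc]

end RN

/-- Over a countably infinite structure `M` over a countable language with ℵ₀-categorical
complete theory, a function between tuple spaces commuting with every automorphism fixing a
finite parameter set `A` pointwise has a graph definable with parameters from `A`. -/
theorem stmt_8 (L : FirstOrder.Language) [Countable L.Symbols]
    (M : Type*) [L.Structure M] [Countable M] [Infinite M]
    (hcat : Cardinal.Categorical ℵ₀ (L.completeTheory M))
    (A : Set M) (hA : A.Finite) (n m : ℕ) (f : (Fin n → M) → (Fin m → M))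
    (hf : ∀ π : M ≃[L] M, (∀ a ∈ A, π a = a) → ∀ x : Fin n → M, f (⇑π ∘ x) = ⇑π ∘ f x) :
    Set.Definable A L {z : Fin n ⊕ Fin m → M | f (z ∘ Sum.inl) = z ∘ Sum.inr} := by

  have := hA.to_subtype
  obtain ⟨φ, hφ⟩ := RN.invariant_definable' hcat
    {w : ↥A ⊕ (Fin n ⊕ Fin m) → M | ∃ (π : M ≃[L] M) (z : Fin n ⊕ Fin m → M),
      f (z ∘ Sum.inl) = z ∘ Sum.inr ∧ w = π ∘ Sum.elim (fun a : A => (a : M)) z} (by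
      rintro σ _ ⟨π, z, hz, rfl⟩
      exact ⟨σ.comp π, z, hz, rfl⟩)
  refine Set.definable_iff_exists_formula_sum.2 ⟨φ, ?_⟩
  ext z
  refine Iff.trans ?_ (hφ (Sum.elim (fun a : A => (a : M)) z))
  constructor
  · intro hz
    exact ⟨FirstOrder.Language.Equiv.refl L M, z, hz, rfl⟩
  · rintro ⟨π, z', hz', h⟩
    have hπ : ∀ a ∈ A, π a = a := fun a ha => (congrFun h (Sum.inl ⟨a, ha⟩)).symm
    have hz : z = π ∘ z' := funext fun i => congrFun h (Sum.inr i)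
    subst hz
    change f (π ∘ (z' ∘ Sum.inl)) = π ∘ (z' ∘ Sum.inr)
    rw [hf π hπ, hz']
end
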